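/- arXiv:1112.1467 — 2 statements merged into one kernel-verified Lean document; each statement's English description precedes it below -/
import Mathlib

section
/- Suppose p ≥ 5 is a prime and 3 ≤ k ≤ p. Let G be a finite p-group acting faithfully on a finite elementary abelian p-group V such that V is both a PS-module of degree k for G and an F-module for G. Then there exists a quadratic element a ∈ G such that W = ⟨a^G⟩ (the normal closure of a in G) is a normal elementary abelian subgroup of G with the property that for every x ∈ G, either [W, x] = 1 or [W, x, x] ≠ 1. -/
/-!
STATEMENT 8 (module-theoretic form of Lemma 5.2):
Suppose `p ≥ 5` is a prime and `3 ≤ k ≤ p`.  Let `G` be a finite `p`-group acting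
faithfully on a finite elementary abelian `p`-group `V` such that `V` is both a
PS-module of degree `k` and an F-module for `G`.  Then there is a quadratic element
`a ∈ G` such that `W = ⟨a^G⟩` is a normal elementary abelian subgroup of `G` with:
for every `x ∈ G`, either `[W, x] = 1` or `[W, x, x] ≠ 1`.
-/

/-- The subgroup `[H, u]` generated by the commutators `[w, u] = w⁻¹u⁻¹wu`, `w ∈ H`. -/
def commSub {S : Type} [Group S] (H : Subgroup S) (u : S) : Subgroup S :=
  Subgroup.closure {x : S | ∃ w ∈ H, x = w⁻¹ * u⁻¹ * w * u}

section NilpotentEndomorphisms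

variable {K V : Type*} [Field K] [AddCommGroup V] [Module K V]

theorem commute_of_mem_span {T : Set (Module.End K V)} (hT : ∀ s ∈ T, ∀ t ∈ T, Commute s t)
    {s t : Module.End K V} (hs : s ∈ Submodule.span K T) (ht : t ∈ Submodule.span K T) :
    Commute s t := by
  induction hs, ht using Submodule.span_induction₂ with
  | mem_mem x y hx hy => exact hT x hx y hy
  | zero_left y hy => exact Commute.zero_left y
  | zero_right x hx => exact Commute.zero_right x
  | add_left x y z _ _ _ h₁ h₂ => exact h₁.add_left h₂
  | add_right x y z _ _ _ h₁ h₂ => exact h₁.add_right h₂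
  | smul_left r x y _ _ h => exact h.smul_left r
  | smul_right r x y _ _ h => exact h.smul_right r

theorem isNilpotent_of_mem_span {T : Set (Module.End K V)}
    (hT : ∀ s ∈ T, ∀ t ∈ T, Commute s t) (hnil : ∀ t ∈ T, IsNilpotent t)
    {s : Module.End K V} (hs : s ∈ Submodule.span K T) : IsNilpotent s := by
  induction hs using Submodule.span_induction with
  | mem x hx => exact hnil x hx
  | zero => exact IsNilpotent.zero
  | add x y hx hy h₁ h₂ => exact (commute_of_mem_span hT hx hy).isNilpotent_add h₁ h₂
  | smul r x _ h => exact h.smul r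

/-- If `v` is congruent to an element of `span {t v | t ∈ T}` modulo the common kernel of a set `T`
of commuting nilpotent endomorphisms, then `T` kills `v`. -/
theorem apply_eq_zero_of_mem_span_sup {T : Set (Module.End K V)}
    (hT : ∀ s ∈ T, ∀ t ∈ T, Commute s t) (hnil : ∀ t ∈ T, IsNilpotent t) {F : Submodule K V}
    (hF : ∀ t ∈ T, ∀ f ∈ F, t f = 0) {v : V}
    (hv : v ∈ Submodule.span K ((fun t : Module.End K V => t v) '' T) ⊔ F)
    {t : Module.End K V} (ht : t ∈ T) : t v = 0 := by
  obtain ⟨m, hm, f, hf, hmf⟩ := Submodule.mem_sup.1 hv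
  have hm' : m ∈ (Submodule.span K T).map (LinearMap.applyₗ v : Module.End K V →ₗ[K] V) := by
    rw [Submodule.map_span]
    exact hm
  obtain ⟨j, hj, rfl⟩ := hm'
  replace hmf : j v + f = v := hmf
  have htj : t (j v) = j (t v) :=
    LinearMap.congr_fun (commute_of_mem_span hT (Submodule.subset_span ht) hj).eq v
  have h₁ : j (t v) = t v := by
    conv_rhs => rw [← hmf, map_add, hF t ht f hf, add_zero, htj]
  obtain ⟨n, hn⟩ := isNilpotent_of_mem_span hT hnil hj
  have h₂ : ∀ n : ℕ, (j ^ n) (t v) = t v := by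
    intro n
    induction n with
    | zero => rfl
    | succ n ih => rw [pow_succ, Module.End.mul_apply, h₁, ih]
  rw [← h₂ n, hn, LinearMap.zero_apply]

end NilpotentEndomorphisms

theorem Module.End.sub_one_pow_char {p : ℕ} [Fact p.Prime] {V : Type*} [AddCommGroup V]
    [Module (ZMod p) V] (f : Module.End (ZMod p) V) : (f - 1) ^ p = f ^ p - 1 := by
  cases subsingleton_or_nontrivial (Module.End (ZMod p) V)
  · exact Subsingleton.elim _ _
  · have : CharP (Module.End (ZMod p) V) p :=
      charP_of_injective_algebraMap (algebraMap (ZMod p) (Module.End (ZMod p) V)).injective p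
    rw [sub_pow_char_of_commute _ (Commute.one_right f), one_pow]

open scoped commutatorElement

section Quadratic

variable {G S : Type*} [Group G] [Ring S] {σ : G →* S}

theorem sub_one_sq_conj {a : G} (ha : (σ a - 1) ^ 2 = 0) (y : G) :
    (σ (y * a * y⁻¹) - 1) ^ 2 = 0 := by
  have hy : σ y⁻¹ * σ y = 1 := by rw [← map_mul, inv_mul_cancel, map_one]
  have hy' : σ y * σ y⁻¹ = 1 := by rw [← map_mul, mul_inv_cancel, map_one]
  have h : σ (y * a * y⁻¹) - 1 = σ y * (σ a - 1) * σ y⁻¹ := by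
    rw [map_mul, map_mul, mul_sub, sub_mul, mul_one, hy']
  calc (σ (y * a * y⁻¹) - 1) ^ 2
      = σ y * (σ a - 1) * (σ y⁻¹ * σ y) * (σ a - 1) * σ y⁻¹ := by rw [h]; noncomm_ring
    _ = σ y * (σ a - 1) ^ 2 * σ y⁻¹ := by rw [hy]; noncomm_ring
    _ = 0 := by rw [ha, mul_zero, zero_mul]

/-- A commutator `⁅a, x⁆` with a quadratic element `a` that commutes with `a` and `x` is
quadratic. -/
theorem sub_one_sq_commutator (h2 : ∀ s : S, s + s = 0 → s = 0) {a x : G}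
    (ha : (σ a - 1) ^ 2 = 0) (hca : Commute ⁅a, x⁆ a) (hcx : Commute ⁅a, x⁆ x) :
    (σ ⁅a, x⁆ - 1) ^ 2 = 0 := by
  set c := ⁅a, x⁆ with hc
  have hax : a * x = c * x * a := by rw [hc, commutatorElement_def]; group
  have e₁ : x⁻¹ * a * x⁻¹⁻¹ = c * a := by
    rw [inv_inv, mul_assoc, hax, hcx.eq]; group
  have e₂ : c * (x * a * x⁻¹) = a := by
    rw [← mul_assoc, ← mul_assoc, ← hax]; group
  have q₁ := sub_one_sq_conj ha x⁻¹
  rw [e₁, map_mul] at q₁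
  have q₂ := sub_one_sq_conj ha x
  have hcd : Commute (σ c) (σ (x * a * x⁻¹)) :=
    Commute.map (hcx.mul_right hca |>.mul_right hcx.inv_right) σ
  have hCA : Commute (σ c) (σ a) := hca.map σ
  obtain ⟨A, hA⟩ : ∃ A, A = σ a - 1 := ⟨_, rfl⟩
  obtain ⟨C, hC⟩ : ∃ C, C = σ c - 1 := ⟨_, rfl⟩
  have hAC : C * A = A * C := by
    rw [hA, hC]
    exact ((hCA.sub_left (Commute.one_left _)).sub_right (Commute.one_right _)).eq
  have q₃ : (C - A) ^ 2 = 0 := by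
    have : C - A = -(σ c * (σ (x * a * x⁻¹) - 1)) := by
      rw [mul_sub, ← map_mul, e₂, hA, hC]; noncomm_ring
    rw [this, neg_sq, (hcd.sub_right (Commute.one_right _)).mul_pow, q₂, mul_zero]
  have a0 : A * A = 0 := by rw [← sq, hA, ha]
  have c2 : C * C = A * C + A * C := by
    have : (C - A) ^ 2 = C * C - (C * A + A * C) + A * A := by noncomm_ring
    rw [q₃, a0, hAC, add_zero] at this
    exact (sub_eq_zero.1 this.symm)
  have ac2 : A * (C * C) = 0 := by
    rw [c2, mul_add, ← mul_assoc, a0, zero_mul, add_zero]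
  have q₄ : C * C + (C * C) = 0 := by
    have h : σ c * σ a - 1 = C + A + A * C := by
      rw [← hAC, hA, hC]; noncomm_ring
    have h' : (C + A + A * C) ^ 2 = C * C + (C * A + A * C) + A * A + A * A * C +
        C * A * C + A * (C * C) + A * (C * A) + A * (C * A) * C := by noncomm_ring
    rw [h, h', hAC, mul_assoc A C C, ac2, ← mul_assoc A A C, a0, ← c2] at q₁
    simpa using q₁
  rw [← hC, sq]
  exact h2 _ q₄

end Quadratic

section Offender

variable {K V G : Type*} [Field K] [AddCommGroup V] [Module K V] [Group G]
  (σ : G →* Module.End K V)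

/-- The vectors fixed by `A`. -/
def fixedVectors (A : Subgroup G) : Submodule K V where
  carrier := {v | ∀ g ∈ A, σ g v = v}
  zero_mem' _ _ := map_zero _
  add_mem' hv hw g hg := by rw [map_add, hv g hg, hw g hg]
  smul_mem' r v hv g hg := by rw [map_smul, hv g hg]

/-- The pointwise stabilizer of `M`. -/
def vectorFixer (M : Submodule K V) : Subgroup G where
  carrier := {g | ∀ m ∈ M, σ g m = m}
  one_mem' m _ := by rw [map_one]; rfl
  mul_mem' hg hh m hm := by rw [map_mul, Module.End.mul_apply, hh m hm, hg m hm]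
  inv_mem' {g} hg m hm := by
    conv_lhs => rw [← hg m hm]
    rw [← Module.End.mul_apply, ← map_mul, inv_mul_cancel, map_one]
    rfl

/-- The endomorphisms `σ x - 1` for `x ∈ A`. -/
def augmentationSet (A : Subgroup G) : Set (Module.End K V) :=
  (fun x => σ x - 1) '' A

/-- The commutator space `[v, A]`, spanned by the vectors `(σ x - 1) v` for `x ∈ A`. -/
def commutatorSpan (A : Subgroup G) (v : V) : Submodule K V :=
  Submodule.span K ((fun t : Module.End K V => t v) '' augmentationSet σ A)

variable {σ}

theorem commute_sub_one {x y : G} (h : Commute x y) : Commute (σ x - 1) (σ y - 1) :=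
  ((h.map σ).sub_left (Commute.one_left _)).sub_right (Commute.one_right _)

theorem sub_one_apply_mem_commutatorSpan {A : Subgroup G} {x : G} (hx : x ∈ A) (v : V) :
    (σ x - 1) v ∈ commutatorSpan σ A v :=
  Submodule.subset_span ⟨_, ⟨x, hx, rfl⟩, rfl⟩

theorem mem_vectorFixer_commutatorSpan {A : Subgroup G}
    (hA : ∀ x ∈ A, ∀ y ∈ A, Commute x y) {c : G} (hc : c ∈ A) {v : V}
    (h : (σ c - 1) v ∈ fixedVectors σ A) : c ∈ vectorFixer σ (commutatorSpan σ A v) := by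
  have hle : commutatorSpan σ A v ≤ LinearMap.ker (σ c - 1) := by
    refine Submodule.span_le.2 ?_
    rintro _ ⟨_, ⟨x, hx, rfl⟩, rfl⟩
    have := LinearMap.congr_fun (commute_sub_one (σ := σ) (hA c hc x hx)).eq v
    refine this.trans ?_
    exact sub_eq_zero.2 (h x hx)
  exact fun m hm => sub_eq_zero.1 (hle hm)

/-- The counting step of Thompson replacement. -/
theorem card_mul_card_fixedVectors_le [Finite G] [Finite V] {A : Subgroup G}
    (hA : ∀ x ∈ A, ∀ y ∈ A, Commute x y) (v : V) :
    Nat.card A * Nat.card (fixedVectors σ A) ≤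
      Nat.card (A ⊓ vectorFixer σ (commutatorSpan σ A v) : Subgroup G) *
        Nat.card (commutatorSpan σ A v ⊔ fixedVectors σ A : Submodule K V) := by
  let L : Submodule K V := commutatorSpan σ A v ⊔ fixedVectors σ A
  let Φ : A × fixedVectors σ A → L := fun q =>
    ⟨(σ q.1 - 1) v + q.2, Submodule.add_mem_sup
      (sub_one_apply_mem_commutatorSpan q.1.2 v) q.2.2⟩
  have key : ∀ q r, Φ q = Φ r →
      ((q.1 : G)⁻¹ * r.1) ∈ A ⊓ vectorFixer σ (commutatorSpan σ A v) := by
    intro q r hqr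
    have hmem : ((q.1 : G)⁻¹ * r.1) ∈ A := A.mul_mem (A.inv_mem q.1.2) r.1.2
    refine ⟨hmem, mem_vectorFixer_commutatorSpan hA hmem ?_⟩
    have h : (σ q.1 v - v) + (q.2 : V) = (σ r.1 v - v) + r.2 := congrArg Subtype.val hqr
    have h' : σ r.1 v = σ q.1 v + (q.2 - r.2 : V) := by
      rw [← sub_eq_zero, ← neg_eq_zero, ← sub_eq_zero.2 h]
      abel
    have hfix : σ (q.1 : G)⁻¹ (q.2 - r.2 : V) = q.2 - r.2 :=
      ((fixedVectors σ A).sub_mem q.2.2 r.2.2) _ (A.inv_mem q.1.2)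
    have : (σ ((q.1 : G)⁻¹ * r.1) - 1) v = q.2 - r.2 := by
      rw [LinearMap.sub_apply, map_mul, Module.End.mul_apply, h', map_add, hfix,
        ← Module.End.mul_apply, ← map_mul, inv_mul_cancel, map_one, Module.End.one_apply,
        add_sub_cancel_left]
    rw [this]
    exact (fixedVectors σ A).sub_mem q.2.2 r.2.2
  have hinv : ∀ q, Φ (Function.invFun Φ (Φ q)) = Φ q := fun q => Function.invFun_eq ⟨q, rfl⟩
  let Ψ : A × fixedVectors σ A →
      (A ⊓ vectorFixer σ (commutatorSpan σ A v) : Subgroup G) × L := fun q =>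
    (⟨_, key _ q (hinv q)⟩, Φ q)
  have hΨ : Function.Injective Ψ := by
    intro q r hqr
    have h₁ : Φ q = Φ r := congrArg Prod.snd hqr
    have h₂ : ((Function.invFun Φ (Φ q)).1 : G)⁻¹ * q.1 =
        ((Function.invFun Φ (Φ r)).1 : G)⁻¹ * r.1 :=
      congrArg (fun s => (s.1 : G)) hqr
    rw [h₁] at h₂
    have h₃ : q.1 = r.1 := Subtype.ext (mul_left_cancel h₂)
    have h₄ : (σ q.1 - 1) v + (q.2 : V) = (σ r.1 - 1) v + r.2 := congrArg Subtype.val h₁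
    rw [h₃] at h₄
    exact Prod.ext h₃ (Subtype.ext (add_left_cancel h₄))
  rw [← Nat.card_prod, ← Nat.card_prod]
  exact Nat.card_le_card_of_injective Ψ hΨ

/-- An offender contains a quadratic element. -/
theorem exists_quadratic_of_offender [Finite G] [Finite V] {E : Subgroup G} (hE : E ≠ ⊥) (hcomm : ∀ x ∈ E, ∀ y ∈ E, Commute x y)
    (hnil : ∀ x ∈ E, IsNilpotent (σ x - 1))
    (hoff : Nat.card V ≤ Nat.card E * Nat.card (fixedVectors σ E)) :
    ∃ a : G, a ≠ 1 ∧ (σ a - 1) ^ 2 = 0 := by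
  obtain ⟨A, ⟨hAbot, hAE, hAoff⟩, hmin⟩ := exists_minimal_of_wellFoundedLT
    (fun A : Subgroup G => A ≠ ⊥ ∧ A ≤ E ∧ Nat.card V ≤ Nat.card A * Nat.card (fixedVectors σ A))
    ⟨E, hE, le_rfl, hoff⟩
  have hA : ∀ x ∈ A, ∀ y ∈ A, Commute x y := fun x hx y hy => hcomm x (hAE hx) y (hAE hy)
  have hfix : ∀ v, A ≤ vectorFixer σ (commutatorSpan σ A v) := by
    intro v
    have hle := hAoff.trans (card_mul_card_fixedVectors_le (σ := σ) hA v)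
    by_cases hC : A ⊓ vectorFixer σ (commutatorSpan σ A v) = ⊥
    · rw [hC, Subgroup.card_bot, one_mul] at hle
      have htop : commutatorSpan σ A v ⊔ fixedVectors σ A = ⊤ := by
        refine SetLike.coe_injective (Set.eq_top_of_card_le_of_finite hle)
      have hzero : ∀ t ∈ augmentationSet σ A, t v = 0 := by
        refine fun t ht => apply_eq_zero_of_mem_span_sup (T := augmentationSet σ A) ?_ ?_
          (F := fixedVectors σ A) ?_ (htop ▸ Submodule.mem_top) ht
        · rintro _ ⟨x, hx, rfl⟩ _ ⟨y, hy, rfl⟩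
          exact commute_sub_one (hA x hx y hy)
        · rintro _ ⟨x, hx, rfl⟩
          exact hnil x (hAE hx)
        · rintro _ ⟨x, hx, rfl⟩ f hf
          exact sub_eq_zero.2 (hf x hx)
      intro x hx
      refine mem_vectorFixer_commutatorSpan hA hx ?_
      rw [hzero _ ⟨x, hx, rfl⟩]
      exact Submodule.zero_mem _
    · refine le_trans (hmin ⟨hC, inf_le_left.trans hAE, hle.trans ?_⟩ inf_le_left) inf_le_right
      refine Nat.mul_le_mul_left _ (Nat.card_mono (Set.toFinite _) ?_)
      refine SetLike.coe_subset_coe.2 (sup_le (fun m hm g hg => hg.2 m hm) ?_)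
      exact fun f hf g hg => hf g hg.1
  obtain ⟨⟨a, haA⟩, ha⟩ := Subgroup.ne_bot_iff_exists_ne_one.1 hAbot
  refine ⟨a, fun h => ha (Subtype.ext h), LinearMap.ext fun v => ?_⟩
  rw [sq]
  exact sub_eq_zero.2 (hfix v haA _ (sub_one_apply_mem_commutatorSpan haA v))

end Offender

section NormalClosure

variable {G : Type*} [Group G]

theorem Subgroup.commute_of_mem_normalClosure_of_forall_conj {a x : G}
    (h : ∀ g, Commute (g * a * g⁻¹) x) {w : G} (hw : w ∈ Subgroup.normalClosure {a}) :
    Commute w x := by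
  have hle : Subgroup.normalClosure {a} ≤ Subgroup.centralizer {x} := by
    refine (Subgroup.closure_le _).2 fun y hy => ?_
    obtain ⟨b, rfl, hb⟩ := Group.mem_conjugatesOfSet_iff.1 hy
    obtain ⟨g, rfl⟩ := isConj_iff.1 hb
    exact Subgroup.mem_centralizer_singleton_iff.2 (h g).eq
  exact Subgroup.mem_centralizer_singleton_iff.1 (hle hw)

/-- If no nontrivial commutator `⁅g * a * g⁻¹, x⁆` commutes with both of its entries, then the
normal closure of `a` is abelian. -/
theorem Subgroup.commute_of_mem_normalClosure [Group.IsNilpotent G] {a : G}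
    (h : ∀ g x, Commute ⁅g * a * g⁻¹, x⁆ (g * a * g⁻¹) → Commute ⁅g * a * g⁻¹, x⁆ x →
      Commute (g * a * g⁻¹) x) {x y : G} (hx : x ∈ Subgroup.normalClosure {a})
    (hy : y ∈ Subgroup.normalClosure {a}) : Commute x y := by
  set N := Subgroup.normalClosure {a} with hN
  have hconj : ∀ g, g * a * g⁻¹ ∈ N := fun g =>
    Subgroup.normalClosure_normal.conj_mem a
      (Subgroup.subset_normalClosure (Set.mem_singleton a)) g
  have hle : ∀ n, N.lowerCentralSeries n ≤ N := by
    intro n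
    induction n with
    | zero => exact le_rfl
    | succ n ih =>
      exact (Subgroup.commutator_mono ih le_rfl).trans (Subgroup.commutator_le_right N N)
  have hstep : ∀ n, N.lowerCentralSeries (n + 2) = ⊥ → N.lowerCentralSeries (n + 1) = ⊥ := by
    intro n hn
    rw [Subgroup.lowerCentralSeries_succ, Subgroup.commutator_eq_bot_iff_le_centralizer] at hn ⊢
    intro z hz
    refine Subgroup.mem_centralizer_iff.2 fun w hw => ?_
    refine Subgroup.commute_of_mem_normalClosure_of_forall_conj (fun g => ?_) hw
    have hc : ⁅g * a * g⁻¹, z⁆ ∈ N.lowerCentralSeries (n + 1) := by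
      rw [← commutatorElement_inv]
      exact inv_mem (Subgroup.commutator_mem_commutator hz (hconj g))
    have hcent := Subgroup.mem_centralizer_iff.1 (hn hc)
    exact h g z (hcent _ (hconj g)).symm (hcent _ (hle n hz)).symm
  have hone : N.lowerCentralSeries 1 = ⊥ := by
    obtain ⟨n, hn⟩ := (Subgroup.isNilpotent_iff_lowerCentralSeries N).1 inferInstance
    have hn' : N.lowerCentralSeries (n + 1) = ⊥ := by
      rw [Subgroup.lowerCentralSeries_succ, hn, Subgroup.commutator_bot_left]
    clear hn
    induction n with
    | zero => exact hn'
    | succ n ih => exact ih (hstep n hn')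
  rw [Subgroup.lowerCentralSeries_succ, Subgroup.commutator_eq_bot_iff_le_centralizer] at hone
  exact (Subgroup.mem_centralizer_iff.1 (hone hx) y hy).symm

/-- Some quadratic element has the property that no nontrivial commutator of one of its conjugates
commutes with both of its entries. -/
theorem exists_quadratic_conj_commute [Group.IsNilpotent G] {S : Type*} [Ring S] (σ : G →* S)
    (h2 : ∀ s : S, s + s = 0 → s = 0) (hquad : ∃ a : G, a ≠ 1 ∧ (σ a - 1) ^ 2 = 0) :
    ∃ a : G, (a ≠ 1 ∧ (σ a - 1) ^ 2 = 0) ∧ ∀ g x, Commute ⁅g * a * g⁻¹, x⁆ (g * a * g⁻¹) →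
      Commute ⁅g * a * g⁻¹, x⁆ x → Commute (g * a * g⁻¹) x := by
  classical
  have hex : ∃ n, ∀ b ∈ (⊤ : Subgroup G).lowerCentralSeries n, (σ b - 1) ^ 2 = 0 → b = 1 := by
    obtain ⟨n, hn⟩ := Subgroup.nilpotent_iff_lowerCentralSeries.1 ‹Group.IsNilpotent G›
    refine ⟨n, fun b hb _ => ?_⟩
    rwa [hn, Subgroup.mem_bot] at hb
  obtain ⟨m, hm⟩ : ∃ m, Nat.find hex = m + 1 := by
    refine Nat.exists_eq_succ_of_ne_zero fun h0 => ?_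
    obtain ⟨a, ha, haq⟩ := hquad
    have hspec := Nat.find_spec hex
    rw [h0] at hspec
    exact ha (hspec a (Subgroup.mem_top a) haq)
  have hlt := Nat.find_min hex (hm.symm ▸ Nat.lt_succ_self m : m < Nat.find hex)
  have hspec := Nat.find_spec hex
  rw [hm] at hspec
  push Not at hlt
  obtain ⟨a, ham, haq, ha⟩ := hlt
  refine ⟨a, ⟨ha, haq⟩, fun g x h₁ h₂ => ?_⟩
  refine commutatorElement_eq_one_iff_commute.1 (hspec _ ?_
    (sub_one_sq_commutator h2 (sub_one_sq_conj haq g) h₁ h₂))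
  exact Subgroup.commutator_mem_commutator
    ((inferInstance : ((⊤ : Subgroup G).lowerCentralSeries m).Normal).conj_mem a ham g)
    (Subgroup.mem_top x)

end NormalClosure

theorem exists_normal_W_of_quadratic_descent
    (p k : ℕ) [Fact p.Prime] (hp : 5 ≤ p) (hk3 : 3 ≤ k) (hkp : k ≤ p)
    (V : Type) [AddCommGroup V] [Module (ZMod p) V] [Finite V]
    (G : Type) [Group G] [Finite G] (hGp : IsPGroup p G)
    (ρ : G →* (V ≃ₗ[ZMod p] V)) (hfaithful : Function.Injective ρ)
    -- `V` is a PS-module of degree `k` for `G`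
    (hPS : ∀ z ∈ Subgroup.center G, z ≠ 1 → z ^ p = 1 →
      k ≤ (minpoly (ZMod p) (ρ z : Module.End (ZMod p) V)).natDegree)
    -- `V` is an F-module for `G`
    (hF : ∃ E : Subgroup G, E ≠ ⊥ ∧ (∀ x ∈ E, ∀ y ∈ E, x * y = y * x) ∧
      (∀ x ∈ E, x ^ p = 1) ∧
      Nat.card V ≤ Nat.card E * Nat.card {v : V | ∀ g ∈ E, ρ g v = v}) :
    -- there is a quadratic element `a` whose normal closure `W = ⟨a^G⟩` is a normal
    -- elementary abelian subgroup such that for each `x ∈ G`, `[W,x] = 1` or `[W,x,x] ≠ 1`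
    ∃ a : G, (a ≠ 1 ∧ ((ρ a : Module.End (ZMod p) V) - 1) ^ 2 = 0) ∧
      (Subgroup.normalClosure ({a} : Set G)).Normal ∧
      (∀ x ∈ Subgroup.normalClosure ({a} : Set G),
        ∀ y ∈ Subgroup.normalClosure ({a} : Set G), x * y = y * x) ∧
      (∀ x ∈ Subgroup.normalClosure ({a} : Set G), x ^ p = 1) ∧
      ∀ x : G, commSub (Subgroup.normalClosure ({a} : Set G)) x = ⊥ ∨
        commSub (commSub (Subgroup.normalClosure ({a} : Set G)) x) x ≠ ⊥ := by
  let σ : G →* Module.End (ZMod p) V := (LinearEquiv.automorphismGroup.toLinearMapMonoidHom).comp ρ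
  have hσ : Function.Injective σ := fun x y h => hfaithful (LinearEquiv.toLinearMap_injective h)
  have h2 : ∀ s : Module.End (ZMod p) V, s + s = 0 → s = 0 := by
    intro s hs
    have hp2 : (2 : ZMod p) ≠ 0 := by
      intro h
      exact absurd (Nat.le_of_dvd two_pos ((ZMod.natCast_eq_zero_iff 2 p).1 h)) (by omega)
    rw [← two_smul (ZMod p) s] at hs
    exact (smul_eq_zero.1 hs).resolve_left hp2
  have hnil : ∀ x, x ^ p = 1 → (σ x - 1) ^ p = 0 := by
    intro x hx
    rw [Module.End.sub_one_pow_char, ← map_pow, hx, map_one, sub_self]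
  have hpow : ∀ x, (σ x - 1) ^ 2 = 0 → x ^ p = 1 := by
    intro x hx
    refine hσ ?_
    rw [map_one, map_pow, ← sub_eq_zero, ← Module.End.sub_one_pow_char]
    exact pow_eq_zero_of_le (by omega) hx
  have : Group.IsNilpotent G := hGp.isNilpotent
  obtain ⟨E, hE, hEcomm, hEp, hEoff⟩ := hF
  obtain ⟨a, ⟨ha, haq⟩, hconj⟩ := exists_quadratic_conj_commute σ h2
    (exists_quadratic_of_offender hE hEcomm (fun x hx => ⟨p, hnil x (hEp x hx)⟩) hEoff)
  have hab : ∀ x ∈ Subgroup.normalClosure {a}, ∀ y ∈ Subgroup.normalClosure {a}, Commute x y :=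
    fun x hx y hy => Subgroup.commute_of_mem_normalClosure hconj hx hy
  have hamem : ∀ g, g * a * g⁻¹ ∈ Subgroup.normalClosure {a} := fun g =>
    Subgroup.normalClosure_normal.conj_mem a
      (Subgroup.subset_normalClosure (Set.mem_singleton a)) g
  refine ⟨a, ⟨ha, haq⟩, Subgroup.normalClosure_normal, hab, fun x hx => ?_, fun x => ?_⟩
  · induction hx using Subgroup.closure_induction with
    | mem y hy =>
      obtain ⟨b, rfl, hb⟩ := Group.mem_conjugatesOfSet_iff.1 hy
      obtain ⟨g, rfl⟩ := isConj_iff.1 hb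
      exact hpow _ (sub_one_sq_conj haq g)
    | one => exact one_pow p
    | mul y z hy hz h₁ h₂ => rw [(hab y hy z hz).mul_pow, h₁, h₂, one_mul]
    | inv y _ h => rw [inv_pow, h, inv_one]
  · rw [or_iff_not_imp_right, not_not]
    intro hxx
    have hcomm : ∀ w ∈ commSub (Subgroup.normalClosure {a}) x, Commute w x := by
      intro w hw
      have h : w⁻¹ * x⁻¹ * w * x = 1 := by
        rw [← Subgroup.mem_bot, ← hxx]
        exact Subgroup.subset_closure ⟨w, hw, rfl⟩
      rw [commute_iff_eq]
      simpa [mul_assoc] using congrArg (x * w * ·) h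
    have hcent : ∀ g, Commute (g * a * g⁻¹) x := by
      intro g
      refine Commute.inv_right_iff.1 (hconj g x⁻¹ (hab _ ?_ _ (hamem g)) (hcomm _ ?_).inv_right)
      · exact Subgroup.commutator_le_left (Subgroup.normalClosure {a}) ⊤
          (Subgroup.commutator_mem_commutator (hamem g) (Subgroup.mem_top _))
      · refine Subgroup.subset_closure ⟨_, inv_mem (hamem g), ?_⟩
        rw [commutatorElement_def, inv_inv, inv_inv]
    refine Subgroup.closure_eq_bot_iff.2 ?_
    rintro _ ⟨w, hw, rfl⟩
    have hwx := Subgroup.commute_of_mem_normalClosure_of_forall_conj hcent hw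
    rw [Set.mem_singleton_iff, mul_assoc, hwx.eq]
    group
end

section
/- Suppose p ≥ 5 is a prime. Let G be a finite p-group acting faithfully on a finite elementary abelian p-group V such that V is both a PS-module of degree 3 for G and an F-module for G. Then every subgroup Q of G admitting a chain 1 = Q_0 < Q_1 < ⋯ < Q_n = Q of subgroups, each normal in G, with [Ω₁(C_G(Q_{i−1})), Q_i, Q_i] = 1 for all 1 ≤ i ≤ n, is a proper subgroup of G. (Equivalently, the third Oliver subgroup 𝔛₃(G) is a proper subgroup of G.) -/
/-!
STATEMENT 11 (module-theoretic form of Proposition 6.1):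
Suppose `p ≥ 5` is a prime.  Let `G` be a finite `p`-group acting faithfully on a
finite elementary abelian `p`-group `V` such that `V` is both a PS-module of degree 3
for `G` and an F-module for `G`.  Then every subgroup `Q` of `G` admitting a chain
`1 = Q_0 < Q_1 < ⋯ < Q_n = Q` of subgroups normal in `G` with
`[Ω₁(C_G(Q_{i−1})), Q_i, Q_i] = 1` for all `1 ≤ i ≤ n` is a proper subgroup of `G`
(equivalently, the third Oliver subgroup `𝔛₃(G)` is proper in `G`).
-/

/-- `Ω₁(C_G(H))`: the subgroup generated by the elements `x` of the centralizer of `H`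
with `x ^ p = 1`. -/
def Omega1Centralizer (p : ℕ) {G : Type} [Group G] (H : Subgroup G) : Subgroup G :=
  Subgroup.closure {x : G | x ∈ Subgroup.centralizer (H : Set G) ∧ x ^ p = 1}

theorem sub_one_sq_eq_zero_of_commRing {S : Type*} [CommRing S] (h2 : ∀ x : S, 2 * x = 0 → x = 0)
    {a e : S} (h0 : (a - 1) * (a - 1) = 0)
    (h1 : (e * a - 1) * (e * a - 1) = 0) (h3 : (e * (e * a) - 1) * (e * (e * a) - 1) = 0) :
    (e - 1) * (e - 1) = 0 := by
  obtain ⟨α, rfl⟩ : ∃ α, a = 1 + α := ⟨a - 1, by ring⟩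
  obtain ⟨γ, rfl⟩ : ∃ γ, e = 1 + γ := ⟨e - 1, by ring⟩
  have hα : α * α = 0 := by linear_combination h0
  have key : ∀ δ : S, ((1 + δ) * (1 + α) - 1) * ((1 + δ) * (1 + α) - 1) = 0 →
      δ * δ = -2 * α * δ := by
    intro δ hδ
    linear_combination (1 - 2 * α) * hδ +
      (-1 + 2 * α + 2 * δ + 4 * δ * α + 3 * δ * δ + 2 * δ * δ * α) * hα
  have hγ := key γ h1
  have hγ2 := key (2 * γ + γ * γ) (by linear_combination h3)
  have hγ3 : γ * γ * γ = 0 := by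
    linear_combination (γ - 2 * α) * hγ + 4 * γ * hα
  have hαγ : α * γ * γ = 0 := by
    linear_combination α * hγ - 2 * γ * hα
  have := h2 (γ * γ) (by linear_combination hγ2 - 2 * hγ - (4 + γ) * hγ3 - 2 * hαγ)
  linear_combination this

theorem mul_sub_sq_sq_eq_zero_of_commRing {S : Type*} [CommRing S]
    (h2 : ∀ x : S, 2 * x = 0 → x = 0)
    {k s t : S} (hXX : (t - 2 * s + k) * (t - 2 * s + k) = 0)
    (hXY : (t - 2 * s + k) * (t * t - 2 * (s * s) + k * k) = 0)
    (hYY : (t * t - 2 * (s * s) + k * k) * (t * t - 2 * (s * s) + k * k) = 0) :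
    (t * k - s * s) * (t * k - s * s) = 0 := by
  apply h2
  apply h2
  linear_combination (4 * s + (t - 2 * s + k)) ^ 2 * hXX -
    2 * (4 * s + (t - 2 * s + k)) * hXY + hYY

open scoped IsMulCommutative in
theorem sub_one_sq_eq_zero_of_commute {R : Type*} [Ring R] (h2 : ∀ x : R, 2 * x = 0 → x = 0)
    {a e : R} (hae : Commute a e) (h0 : (a - 1) * (a - 1) = 0)
    (h1 : (e * a - 1) * (e * a - 1) = 0) (h3 : (e * (e * a) - 1) * (e * (e * a) - 1) = 0) :
    (e - 1) * (e - 1) = 0 := by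
  have hcomm : ∀ x ∈ ({a, e} : Set R), ∀ y ∈ ({a, e} : Set R), x * y = y * x := by
    rintro x (rfl | rfl) y (rfl | rfl)
    exacts [rfl, hae, hae.symm, rfl]
  have := Subring.isMulCommutative_closure hcomm
  have ha : a ∈ Subring.closure ({a, e} : Set R) := Subring.subset_closure (by simp)
  have he : e ∈ Subring.closure ({a, e} : Set R) := Subring.subset_closure (by simp)
  exact congrArg Subtype.val (sub_one_sq_eq_zero_of_commRing
    (S := Subring.closure ({a, e} : Set R)) (a := ⟨a, ha⟩) (e := ⟨e, he⟩)
    (fun x hx => Subtype.ext (h2 x (congrArg Subtype.val hx)))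
    (Subtype.ext h0) (Subtype.ext h1) (Subtype.ext h3))

open scoped IsMulCommutative in
theorem mul_sub_sq_sq_eq_zero_of_commute {R : Type*} [Ring R] (h2 : ∀ x : R, 2 * x = 0 → x = 0)
    {k s t : R} (hks : Commute k s) (hkt : Commute k t) (hst : Commute s t)
    (hXX : (t - 2 * s + k) * (t - 2 * s + k) = 0)
    (hXY : (t - 2 * s + k) * (t * t - 2 * (s * s) + k * k) = 0)
    (hYY : (t * t - 2 * (s * s) + k * k) * (t * t - 2 * (s * s) + k * k) = 0) :
    (t * k - s * s) * (t * k - s * s) = 0 := by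
  have hcomm : ∀ x ∈ ({k, s, t} : Set R), ∀ y ∈ ({k, s, t} : Set R), x * y = y * x := by
    rintro x (rfl | rfl | rfl) y (rfl | rfl | rfl)
    exacts [rfl, hks, hkt, hks.symm, rfl, hst, hkt.symm, hst.symm, rfl]
  have := Subring.isMulCommutative_closure hcomm
  have hk : k ∈ Subring.closure ({k, s, t} : Set R) := Subring.subset_closure (by simp)
  have hs : s ∈ Subring.closure ({k, s, t} : Set R) := Subring.subset_closure (by simp)
  have ht : t ∈ Subring.closure ({k, s, t} : Set R) := Subring.subset_closure (by simp)
  exact congrArg Subtype.val (mul_sub_sq_sq_eq_zero_of_commRing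
    (S := Subring.closure ({k, s, t} : Set R)) (k := ⟨k, hk⟩) (s := ⟨s, hs⟩) (t := ⟨t, ht⟩)
    (fun x hx => Subtype.ext (h2 x (congrArg Subtype.val hx)))
    (Subtype.ext hXX) (Subtype.ext hXY) (Subtype.ext hYY))

section QuadraticElements

open scoped commutatorElement

variable {G R : Type*} [Group G] [Ring R]

/-- `g` acts quadratically through `φ`: `(φ g - 1) ^ 2 = 0`. -/
def IsQuadratic (φ : G →* R) (g : G) : Prop := (φ g - 1) * (φ g - 1) = 0

theorem IsQuadratic.inv {φ : G →* R} {g : G} (h : IsQuadratic φ g) : IsQuadratic φ g⁻¹ := by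
  unfold IsQuadratic at *
  have h1 : φ g⁻¹ - 1 = -(φ g⁻¹ * (φ g - 1)) := by
    rw [mul_sub, ← map_mul]; simp
  have h2 : φ g⁻¹ - 1 = -((φ g - 1) * φ g⁻¹) := by
    rw [sub_mul, ← map_mul]; simp
  calc (φ g⁻¹ - 1) * (φ g⁻¹ - 1)
      = (-(φ g⁻¹ * (φ g - 1))) * (-((φ g - 1) * φ g⁻¹)) := by rw [← h1, ← h2]
    _ = φ g⁻¹ * ((φ g - 1) * (φ g - 1)) * φ g⁻¹ := by noncomm_ring
    _ = 0 := by rw [h]; simp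

theorem IsQuadratic.conj {φ : G →* R} {g : G} (h : IsQuadratic φ g) (x : G) :
    IsQuadratic φ (x * g * x⁻¹) := by
  unfold IsQuadratic at *
  have h1 : φ (x * g * x⁻¹) - 1 = φ x * (φ g - 1) * φ x⁻¹ := by
    rw [mul_sub, sub_mul, ← map_mul, ← map_mul, mul_one, ← map_mul]; simp
  have h2 : φ x⁻¹ * φ x = 1 := by rw [← map_mul]; simp
  calc (φ (x * g * x⁻¹) - 1) * (φ (x * g * x⁻¹) - 1)
      = φ x * (φ g - 1) * (φ x⁻¹ * φ x) * (φ g - 1) * φ x⁻¹ := by rw [h1]; noncomm_ring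
    _ = φ x * ((φ g - 1) * (φ g - 1)) * φ x⁻¹ := by rw [h2]; noncomm_ring
    _ = 0 := by rw [h]; simp

theorem IsQuadratic.commutatorElement (h2 : ∀ x : R, 2 * x = 0 → x = 0) {φ : G →* R} {a b : G}
    (ha : IsQuadratic φ a) (hca : Commute ⁅a, b⁆ a) (hcb : Commute ⁅a, b⁆ b) :
    IsQuadratic φ ⁅a, b⁆ := by
  have h1 : ⁅a, b⁆⁻¹ * a = b * a * b⁻¹ := by rw [commutatorElement_def]; group
  have h3 : ⁅a, b⁆⁻¹ * (⁅a, b⁆⁻¹ * a) = b * (b * a * b⁻¹) * b⁻¹ := by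
    rw [← h1, ← mul_assoc b, ← hcb.inv_left.eq, h1]; group
  have q1 := ha.conj b
  have q3 := q1.conj b
  rw [← h3] at q3
  rw [← h1] at q1
  unfold IsQuadratic at ha q1 q3
  simp only [map_mul] at q1 q3
  have := sub_one_sq_eq_zero_of_commute h2 (hca.inv_left.symm.map φ) ha q1 q3
  simpa using IsQuadratic.inv (φ := φ) (g := ⁅a, b⁆⁻¹) this

theorem IsQuadratic.commutatorElement_commutatorElement (h2 : ∀ x : R, 2 * x = 0 → x = 0)
    {φ : G →* R} {a k : G} (ha : IsQuadratic φ a) (hks : Commute k (a * k * a⁻¹))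
    (hkt : Commute k (a * (a * k * a⁻¹) * a⁻¹)) : IsQuadratic φ ⁅a, ⁅a, k⁆⁆ := by
  have hst : Commute (a * k * a⁻¹) (a * (a * k * a⁻¹) * a⁻¹) := by
    simpa using hks.map (MulAut.conj a)
  have conj2 : ∀ g : G, φ (a * (a * g * a⁻¹) * a⁻¹) - 2 * φ (a * g * a⁻¹) + φ g
      = -2 * ((φ a - 1) * φ g * (φ a - 1)) := by
    intro g
    have hinv : φ a⁻¹ = 2 - φ a := by
      have h1 : φ a⁻¹ * φ a = 1 := by rw [← map_mul]; simp
      have h3 : φ a * (2 - φ a) = 1 - (φ a - 1) * (φ a - 1) := by noncomm_ring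
      rw [ha, sub_zero] at h3
      calc φ a⁻¹ = φ a⁻¹ * (φ a * (2 - φ a)) := by rw [h3, mul_one]
        _ = 2 - φ a := by rw [← mul_assoc, h1, one_mul]
    simp only [map_mul, hinv]
    obtain ⟨α, hα⟩ : ∃ α, φ a = 1 + α := ⟨φ a - 1, by simp⟩
    have hαα : α * α = 0 := by
      have := ha
      unfold IsQuadratic at this
      rwa [hα, add_sub_cancel_left] at this
    have h5 : ∀ x : R, α * (α * x) = 0 := fun x => by rw [← mul_assoc, hαα, zero_mul]
    have h4 : (2 : R) - (1 + α) = 1 - α := by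
      rw [← one_add_one_eq_two]; abel
    rw [hα, h4, add_sub_cancel_left]
    simp only [mul_add, add_mul, mul_sub, sub_mul, mul_assoc, one_mul, mul_one, h5, hαα, mul_zero,
      two_mul, neg_mul]
    abel
  have sandwich : ∀ x y : R, (-2 * ((φ a - 1) * x * (φ a - 1))) * (-2 * ((φ a - 1) * y * (φ a - 1)))
      = 0 := by
    intro x y
    have : (-2 * ((φ a - 1) * x * (φ a - 1))) * (-2 * ((φ a - 1) * y * (φ a - 1)))
      = 4 * ((φ a - 1) * x * ((φ a - 1) * (φ a - 1)) * y * (φ a - 1)) := by noncomm_ring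
    rw [this, ha]; simp
  have e1 := conj2 k
  have e2 := conj2 (k * k)
  rw [show a * (a * (k * k) * a⁻¹) * a⁻¹ =
      (a * (a * k * a⁻¹) * a⁻¹) * (a * (a * k * a⁻¹) * a⁻¹) by group,
    show a * (k * k) * a⁻¹ = (a * k * a⁻¹) * (a * k * a⁻¹) by group] at e2
  rw [map_mul φ (a * (a * k * a⁻¹) * a⁻¹), map_mul φ (a * k * a⁻¹), map_mul φ k] at e2
  have main := mul_sub_sq_sq_eq_zero_of_commute h2 (hks.map φ) (hkt.map φ) (hst.map φ)
    (by rw [e1]; exact sandwich _ _) (by rw [e1, e2]; exact sandwich _ _)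
    (by rw [e2]; exact sandwich _ _)
  set s := a * k * a⁻¹ with hs
  set t := a * s * a⁻¹ with ht
  have hd : ⁅a, ⁅a, k⁆⁆ = (t * k) * (s * s)⁻¹ := by
    have : ⁅a, ⁅a, k⁆⁆ = t * (s⁻¹ * k) * s⁻¹ := by
      rw [ht, hs]; simp only [commutatorElement_def]; group
    rw [this, ← hks.inv_right.eq]; group
  have hc : Commute (s * s)⁻¹ (t * k) :=
    (((hst.mul_left hst).mul_right (hks.symm.mul_left hks.symm))).inv_left
  have hc' : Commute (s * s)⁻¹ (s * s) := (Commute.refl _).inv_left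
  have h1 : φ (s * s) * φ (s * s)⁻¹ = 1 := by rw [← map_mul]; simp
  have hd1 : φ ⁅a, ⁅a, k⁆⁆ - 1 = (φ t * φ k - φ s * φ s) * φ (s * s)⁻¹ := by
    rw [sub_mul, ← map_mul φ s, h1, hd, map_mul, map_mul]
  have hcc : Commute (φ (s * s)⁻¹) (φ t * φ k - φ s * φ s) := by
    rw [← map_mul, ← map_mul]
    exact (hc.map φ).sub_right (hc'.map φ)
  unfold IsQuadratic
  rw [hd1, mul_assoc, ← mul_assoc (φ (s * s)⁻¹), hcc.eq, ← mul_assoc, ← mul_assoc, main]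
  simp

theorem IsQuadratic.pow_eq {φ : G →* R} {a : G} (ha : IsQuadratic φ a) (n : ℕ) :
    φ a ^ n = 1 + (n : R) * (φ a - 1) := by
  induction n with
  | zero => simp
  | succ n ih =>
    have : (1 + (n : R) * (φ a - 1)) * φ a
        = 1 + ((n + 1 : ℕ) : R) * (φ a - 1) + n * ((φ a - 1) * (φ a - 1)) := by
      push_cast; noncomm_ring
    rw [pow_succ, ih, this, ha, mul_zero, add_zero]

theorem exists_quadratic_mem_of_comm (h2 : ∀ x : R, 2 * x = 0 → x = 0) {φ : G →* R}
    {K : Subgroup G} (hK : K.Normal) (hKcomm : ∀ x ∈ K, ∀ y ∈ K, Commute x y) {a x : G}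
    (ha : IsQuadratic φ a) (hc : ⁅a, x⁆ ∈ K) (hc1 : ⁅a, x⁆ ≠ 1) (hcx : Commute ⁅a, x⁆ x) :
    ∃ y ∈ K, y ≠ 1 ∧ IsQuadratic φ y := by
  have hcomm : ∀ y ∈ K, ⁅a, y⁆ ∈ K := fun y hy =>
    K.mul_mem (hK.conj_mem y hy a) (K.inv_mem hy)
  have hconj : ∀ y ∈ K, a * y * a⁻¹ ∈ K := fun y hy => hK.conj_mem y hy a
  have hm := hcomm _ hc
  have hd := hcomm _ hm
  by_cases hd1 : ⁅a, ⁅a, ⁅a, x⁆⁆⁆ = 1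
  · by_cases hm1 : ⁅a, ⁅a, x⁆⁆ = 1
    · exact ⟨_, hc, hc1, ha.commutatorElement h2
        (commutatorElement_eq_one_iff_commute.mp hm1).symm hcx⟩
    · exact ⟨_, hm, hm1, ha.commutatorElement h2
        (commutatorElement_eq_one_iff_commute.mp hd1).symm (hKcomm _ hm _ hc)⟩
  · exact ⟨_, hd, hd1, ha.commutatorElement_commutatorElement h2
      (hKcomm _ hc _ (hconj _ hc)) (hKcomm _ hc _ (hconj _ (hconj _ hc)))⟩

theorem exists_central_quadratic_of_chain {p : ℕ} {G : Type} [Group G] {R : Type*} [Ring R]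
    (h2 : ∀ x : R, 2 * x = 0 → x = 0) {φ : G →* R}
    (hpow : ∀ a, IsQuadratic φ a → a ^ p = 1) {n : ℕ} {Qc : ℕ → Subgroup G}
    (hn : Qc n = ⊤) (hnorm : ∀ i ≤ n, (Qc i).Normal)
    (hQ : ∀ i < n, ⁅⁅Omega1Centralizer p (Qc i), Qc (i + 1)⁆, Qc (i + 1)⁆ = ⊥)
    {i : ℕ} (hi : i ≤ n) {a : G} (ha : IsQuadratic φ a) (ha1 : a ≠ 1)
    (hai : a ∈ Subgroup.centralizer (Qc i : Set G)) :
    ∃ z ∈ Subgroup.center G, z ≠ 1 ∧ IsQuadratic φ z := by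
  induction hi using Nat.decreasingInduction generalizing a with
  | self =>
    rw [hn, Subgroup.coe_top, Subgroup.centralizer_univ] at hai
    exact ⟨a, hai, ha1, ha⟩
  | of_succ i hi ih =>
    by_cases hs : a ∈ Subgroup.centralizer (Qc (i + 1) : Set G)
    · exact ih ha ha1 hs
    obtain ⟨x, hx, hxa⟩ : ∃ x ∈ Qc (i + 1), x * a ≠ a * x := by
      simpa [Subgroup.mem_centralizer_iff] using hs
    have hN := hnorm (i + 1) hi
    have hNi := hnorm i hi.le
    have hD : (Omega1Centralizer p (Qc i)).Normal := by
      constructor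
      intro g hg y
      unfold Omega1Centralizer at *
      have hC : (Subgroup.centralizer (Qc i : Set G)).Normal := inferInstance
      induction hg using Subgroup.closure_induction with
      | mem g hg =>
        refine Subgroup.subset_closure ⟨hC.conj_mem _ hg.1 _, ?_⟩
        rw [conj_pow, hg.2]; simp
      | one => simp
      | mul g h _ _ hg hh => simpa using Subgroup.mul_mem _ hg hh
      | inv g _ hg => simpa [mul_assoc] using Subgroup.inv_mem _ hg
    set K := ⁅Omega1Centralizer p (Qc i), Qc (i + 1)⁆ with hKdef
    have hKn : K.Normal := Subgroup.commutator_normal _ _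
    have hKQ : K ≤ Qc (i + 1) := Subgroup.commutator_le_right _ _
    have hKc : K ≤ Subgroup.centralizer (Qc (i + 1) : Set G) :=
      Subgroup.commutator_eq_bot_iff_le_centralizer.mp (hQ i hi)
    have hcomm : ∀ u ∈ K, ∀ v ∈ Qc (i + 1), Commute u v := fun u hu v hv =>
      (Subgroup.mem_centralizer_iff.mp (hKc hu) v hv).symm
    have hcK : ⁅a, x⁆ ∈ K :=
      Subgroup.commutator_mem_commutator (Subgroup.subset_closure ⟨hai, hpow a ha⟩) hx
    obtain ⟨y, hy, hy1, hyq⟩ := exists_quadratic_mem_of_comm h2 hKn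
      (fun u hu v hv => hcomm u hu v (hKQ hv)) ha hcK
      (fun h => hxa (commutatorElement_eq_one_iff_mul_comm.mp h).symm) (hcomm _ hcK _ hx)
    exact ih hyq hy1 (hKc hy)

end QuadraticElements

theorem eq_zero_of_map_eq_two_smul {p : ℕ} [Fact p.Prime] {V : Type*} [AddCommGroup V]
    [Module (ZMod p) V] {G : Type*} [Group G] {ρ : G →* (V ≃ₗ[ZMod p] V)} {a : G} (hap : a ^ p = 1)
    {w : V} (hw : ρ a w = (2 : ZMod p) • w) : w = 0 := by
  have key : ∀ n : ℕ, ρ (a ^ n) w = (2 : ZMod p) ^ n • w := by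
    intro n
    induction n with
    | zero => simp
    | succ n ih =>
      rw [pow_succ, map_mul, LinearEquiv.mul_apply, hw, map_smul, ih, smul_smul, pow_succ']
  have h := key p
  rw [hap, map_one, ZMod.pow_card, two_smul] at h
  exact left_eq_add.mp h

/-- The elements of `A` acting trivially on every `ρ a v - v` with `a ∈ A`. -/
def commutatorStabilizer {p : ℕ} {V : Type*} [AddCommGroup V] [Module (ZMod p) V]
    {G : Type*} [Group G] (ρ : G →* (V ≃ₗ[ZMod p] V)) (A : Subgroup G) (v : V) : Subgroup G where
  carrier := {b | b ∈ A ∧ ∀ a ∈ A, ρ b (ρ a v - v) = ρ a v - v}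
  one_mem' := ⟨A.one_mem, fun a _ => by simp⟩
  mul_mem' := fun hx hy => ⟨A.mul_mem hx.1 hy.1, fun a ha => by
    rw [map_mul, LinearEquiv.mul_apply, hy.2 a ha, hx.2 a ha]⟩
  inv_mem' := fun {x} hx => ⟨A.inv_mem hx.1, fun a ha => by
    conv_lhs => rw [← hx.2 a ha]
    rw [← LinearEquiv.mul_apply, ← map_mul]; simp⟩

section Offender

variable {p : ℕ} [Fact p.Prime] {V : Type*} [AddCommGroup V] [Module (ZMod p) V]
  {G : Type*} [Group G] {ρ : G →* (V ≃ₗ[ZMod p] V)} {A : Subgroup G}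

theorem inv_mul_mem_commutatorStabilizer (hcomm : ∀ x ∈ A, ∀ y ∈ A, x * y = y * x) {v c c' : V}
    {x y : G} (hx : x ∈ A) (hy : y ∈ A) (hc : ∀ g ∈ A, ρ g c = c) (hc' : ∀ g ∈ A, ρ g c' = c')
    (h : (ρ x v - v) + c = (ρ y v - v) + c') : y⁻¹ * x ∈ commutatorStabilizer ρ A v := by
  have hyx : y⁻¹ * x ∈ A := A.mul_mem (A.inv_mem hy) hx
  refine ⟨hyx, fun a ha => ?_⟩
  have hxv : ρ x v = ρ y v + (c' - c) := by
    rw [sub_add_eq_add_sub, sub_add_eq_add_sub, sub_left_inj] at h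
    rw [add_sub, ← h, add_sub_cancel_right]
  have h1 : ρ (y⁻¹ * x) v = v + (c' - c) := by
    rw [map_mul, LinearEquiv.mul_apply, hxv, map_add, map_sub, hc _ (A.inv_mem hy),
      hc' _ (A.inv_mem hy), ← LinearEquiv.mul_apply, ← map_mul]
    simp
  rw [map_sub, ← LinearEquiv.mul_apply, ← map_mul, hcomm _ hyx _ ha, map_mul,
    LinearEquiv.mul_apply, h1, map_add, map_sub, hc _ ha, hc' _ ha]
  abel

theorem card_le_card_commutatorStabilizer [Finite V] [Finite G]
    (hcomm : ∀ x ∈ A, ∀ y ∈ A, x * y = y * x) (v : V) :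
    Nat.card A * Nat.card {v : V | ∀ g ∈ A, ρ g v = v} ≤
      Nat.card (commutatorStabilizer ρ A v) *
        Nat.card {w : V | ∀ g ∈ commutatorStabilizer ρ A v, ρ g w = w} := by
  set B := commutatorStabilizer ρ A v with hB
  have hBA : B ≤ A := fun b hb => hb.1
  rw [← Subgroup.card_mul_index (B.subgroupOf A),
    Nat.card_congr (Subgroup.subgroupOfEquivOfLe hBA).toEquiv, mul_assoc]
  refine Nat.mul_le_mul_left _ ?_
  rw [Subgroup.index, ← Nat.card_prod]
  refine Nat.card_le_card_of_injective (fun q => ⟨(ρ q.1.out v - v) + q.2, fun g hg => ?_⟩) ?_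
  · rw [map_add, hg.2 _ q.1.out.2, q.2.2 g (hBA hg)]
  · rintro ⟨q, c, hc⟩ ⟨r, d, hd⟩ h
    have h : (ρ q.out v - v) + c = (ρ r.out v - v) + d := congrArg Subtype.val h
    have hqr : q = r := by
      rw [← q.out_eq', ← r.out_eq', eq_comm, QuotientGroup.eq]
      exact inv_mul_mem_commutatorStabilizer hcomm q.out.2 r.out.2 hc hd h
    subst hqr
    simpa using h

theorem commutatorStabilizer_ne_bot [Finite V] [Finite G]
    (hA : A ≠ ⊥) (hcomm : ∀ x ∈ A, ∀ y ∈ A, x * y = y * x)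
    (hpow : ∀ x ∈ A, x ^ p = 1)
    (hcard : Nat.card V ≤ Nat.card A * Nat.card {v : V | ∀ g ∈ A, ρ g v = v}) (v : V) :
    commutatorStabilizer ρ A v ≠ ⊥ := by
  intro hbot
  let f : A × {v : V | ∀ g ∈ A, ρ g v = v} → V := fun q => (ρ q.1 v - v) + q.2
  have hinj : Function.Injective f := by
    rintro ⟨⟨x, hx⟩, c, hc⟩ ⟨⟨y, hy⟩, d, hd⟩ h
    have h : (ρ x v - v) + c = (ρ y v - v) + d := h
    have := inv_mul_mem_commutatorStabilizer hcomm hx hy hc hd h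
    rw [hbot, Subgroup.mem_bot, inv_mul_eq_one] at this
    subst this
    simpa using h
  have hbij : Function.Bijective f :=
    (Nat.bijective_iff_injective_and_card f).mpr
      ⟨hinj, le_antisymm (Nat.card_le_card_of_injective f hinj) (by rwa [Nat.card_prod])⟩
  obtain ⟨⟨⟨a, ha⟩, c, hc⟩, hac⟩ := hbij.2 v
  have hac : (ρ a v - v) + c = v := hac
  have hav : ρ a v = v := by
    rw [← sub_eq_zero]
    refine eq_zero_of_map_eq_two_smul (ρ := ρ) (hpow a ha) ?_
    have h := congrArg (ρ a) hac
    rw [map_add, hc a ha] at h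
    rw [two_smul]
    rw [eq_sub_of_add_eq h, eq_sub_of_add_eq' hac]
    abel
  have hvc : c = v := by rwa [hav, sub_self, zero_add] at hac
  subst hvc
  refine hA (le_bot_iff.mp (hbot ▸ fun b hb => ⟨hb, fun a ha => ?_⟩))
  rw [hc a ha, sub_self, map_zero]

theorem exists_ne_one_quadratic [Finite V] [Finite G]
    (hA : A ≠ ⊥) (hcomm : ∀ x ∈ A, ∀ y ∈ A, x * y = y * x)
    (hpow : ∀ x ∈ A, x ^ p = 1)
    (hcard : Nat.card V ≤ Nat.card A * Nat.card {v : V | ∀ g ∈ A, ρ g v = v}) :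
    ∃ a : G, a ≠ 1 ∧ ∀ v, ρ a (ρ a v - v) = ρ a v - v := by
  induction A using WellFoundedLT.induction with
  | ind A ih =>
    by_cases h : ∃ v, commutatorStabilizer ρ A v < A
    · obtain ⟨v, hv⟩ := h
      exact ih _ hv (commutatorStabilizer_ne_bot hA hcomm hpow hcard v)
        (fun x hx y hy => hcomm x hx.1 y hy.1) (fun x hx => hpow x hx.1)
        (hcard.trans (card_le_card_commutatorStabilizer hcomm v))
    · obtain ⟨⟨a, ha⟩, ha1⟩ := A.ne_bot_iff_exists_ne_one.mp hA
      refine ⟨a, fun h => ha1 (Subtype.ext h), fun v => ?_⟩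
      have hle : commutatorStabilizer ρ A v ≤ A := fun b hb => hb.1
      have haB : a ∈ commutatorStabilizer ρ A v := by
        rwa [hle.eq_of_not_lt fun hlt => h ⟨v, hlt⟩]
      exact haB.2 a ha

end Offender

theorem oliver_X3_proper
    (p : ℕ) [Fact p.Prime] (hp : 5 ≤ p)
    (V : Type) [AddCommGroup V] [Module (ZMod p) V] [Finite V]
    (G : Type) [Group G] [Finite G] (hGp : IsPGroup p G)
    (ρ : G →* (V ≃ₗ[ZMod p] V)) (hfaithful : Function.Injective ρ)
    -- `V` is a PS-module of degree 3 for `G`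
    (hPS : ∀ z ∈ Subgroup.center G, z ≠ 1 → z ^ p = 1 →
      3 ≤ (minpoly (ZMod p) (ρ z : Module.End (ZMod p) V)).natDegree)
    -- `V` is an F-module for `G`
    (hF : ∃ E : Subgroup G, E ≠ ⊥ ∧ (∀ x ∈ E, ∀ y ∈ E, x * y = y * x) ∧
      (∀ x ∈ E, x ^ p = 1) ∧
      Nat.card V ≤ Nat.card E * Nat.card {v : V | ∀ g ∈ E, ρ g v = v}) :
    -- every subgroup `Q` with an Oliver chain of quality `3` is proper in `G`
    ∀ Q : Subgroup G,
      (∃ (n : ℕ) (Qc : ℕ → Subgroup G),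
        Qc 0 = ⊥ ∧ Qc n = Q ∧
        (∀ i < n, Qc i < Qc (i + 1)) ∧
        (∀ i ≤ n, (Qc i).Normal) ∧
        (∀ i < n, ⁅⁅Omega1Centralizer p (Qc i), Qc (i + 1)⁆, Qc (i + 1)⁆ = ⊥)) →
      Q ≠ ⊤ := by
  rintro Q ⟨n, Qc, h0, hn, -, hnorm, hQ⟩ rfl
  obtain ⟨E, hE1, hEcomm, hEpow, hEcard⟩ := hF
  obtain ⟨a, ha1, ha⟩ := exists_ne_one_quadratic hE1 hEcomm hEpow hEcard
  let φ : G →* Module.End (ZMod p) V :=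
    (LinearEquiv.automorphismGroup.toLinearMapMonoidHom (R := ZMod p) (M := V)).comp ρ
  have h2 : ∀ x : Module.End (ZMod p) V, 2 * x = 0 → x = 0 := by
    intro x hx
    have h2ne : (2 : ZMod p) ≠ 0 := by
      intro h
      have := (ZMod.natCast_eq_zero_iff 2 p).mp (by exact_mod_cast h)
      exact absurd (Nat.le_of_dvd two_pos this) (by omega)
    rw [two_mul, ← two_smul (ZMod p)] at hx
    exact (smul_eq_zero.mp hx).resolve_left h2ne
  have hφ : Function.Injective φ := fun x y hxy =>
    hfaithful (LinearEquiv.toLinearMap_injective hxy)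
  have hpow : ∀ g, IsQuadratic φ g → g ^ p = 1 := by
    intro g hg
    apply hφ
    rw [map_pow, hg.pow_eq, map_one]
    have hp0 : (p : Module.End (ZMod p) V) = 0 := by
      ext v
      simp [Module.End.natCast_apply, ← Nat.cast_smul_eq_nsmul (ZMod p)]
    rw [hp0, zero_mul, add_zero]
  have haq : IsQuadratic φ a := by
    refine LinearMap.ext fun v => ?_
    change ρ a (ρ a v - v) - (ρ a v - v) = 0
    rw [ha, sub_self]
  obtain ⟨z, hz, hz1, hzq⟩ := exists_central_quadratic_of_chain h2 hpow hn hnorm hQ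
    (Nat.zero_le n) haq ha1 (by rw [h0, Subgroup.mem_centralizer_iff]; simp)
  have hdeg := hPS z hz hz1 (hpow z hzq)
  have hmonic : ((Polynomial.X - Polynomial.C 1) ^ 2 : Polynomial (ZMod p)).Monic :=
    (Polynomial.monic_X_sub_C 1).pow 2
  have hle := Polynomial.natDegree_le_natDegree
    (minpoly.min (ZMod p) (φ z) hmonic (by simpa [sq, IsQuadratic] using hzq))
  rw [Polynomial.natDegree_pow, Polynomial.natDegree_X_sub_C] at hle
  exact absurd (hdeg.trans hle) (by norm_num)
end
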